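/- Let G be a group acting on a linearly ordered set X, H ≤ G a subgroup, and T ⊆ G a finite right transversal of H in G. Suppose CF_H : X → X satisfies CF_H(h • x) = CF_H(x) for all h ∈ H, x ∈ X, and CF_H(x) ∈ H • x for all x ∈ X. Fix x ∈ X, let c := min_{t ∈ T} CF_H(t • x), let t₁, …, t_m ∈ T be exactly those transversal elements with CF_H(t_i • x) = c, and for each i choose h_i ∈ H with (h_i t_i) • x = c, setting τ_i := h_i t_i. Then the stabilizer Stab_G(x) is generated by the elements τ₁⁻¹ τ_i (i = 2, …, m) together with the conjugate subgroup τ₁⁻¹ · Stab_H(c) · τ₁, where Stab_H(c) = {h ∈ H : h • c = c}. -/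

import Mathlib

/-- With an `H`-canonical form `CF` and a finite right transversal `T` of
`H ≤ G`, fix `x`, let `c := min_{t ∈ T} CF (t • x)`, and for every `t ∈ T` attaining the
minimum choose `σ t ∈ H` with `(σ t * t) • x = c`.  If `t₁` is one such transversal
element, then `Stab_G x` is generated by the elements `(σ t₁ * t₁)⁻¹ * (σ t * t)` for the
minimizing `t ∈ T` together with the conjugate `(σ t₁ * t₁)⁻¹ · Stab_H c · (σ t₁ * t₁)`. -/
theorem stabilizer_eq_closure_of_lifting
    {G X : Type*} [Group G] [MulAction G X] [LinearOrder X]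
    (H : Subgroup G) (T : Finset G)
    (hT : ∀ g : G, ∃! t, t ∈ T ∧ g * t⁻¹ ∈ H)  -- `T` is a right transversal of `H` in `G`
    (hTne : T.Nonempty)
    (CF : X → X)
    (hinv : ∀ h ∈ H, ∀ x : X, CF (h • x) = CF x)
    (horb : ∀ x : X, ∃ h ∈ H, CF x = h • x)
    (x : X) (c : X)
    (hc : c = (T.image fun t => CF (t • x)).min' (hTne.image _))
    (σ : G → G)
    (hσH : ∀ t ∈ T, CF (t • x) = c → σ t ∈ H)
    (hσact : ∀ t ∈ T, CF (t • x) = c → (σ t * t) • x = c)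
    (t₁ : G) (ht₁ : t₁ ∈ T) (ht₁c : CF (t₁ • x) = c) :
    MulAction.stabilizer G x = Subgroup.closure
      ({ g : G | ∃ t ∈ T, CF (t • x) = c ∧ g = (σ t₁ * t₁)⁻¹ * (σ t * t) } ∪
       { g : G | ∃ k ∈ H, k • c = c ∧ g = (σ t₁ * t₁)⁻¹ * k * (σ t₁ * t₁) }) := by
  have hτ : (σ t₁ * t₁) • x = c := hσact t₁ ht₁ ht₁c
  have hτinv : (σ t₁ * t₁)⁻¹ • c = x := by rw [← hτ, inv_smul_smul]
  have hCFc : CF c = c := by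
    have hCF := hinv _ (hσH t₁ ht₁ ht₁c) (t₁ • x)
    rwa [← mul_smul, hτ, ht₁c] at hCF
  apply le_antisymm
  · intro g hg
    rw [MulAction.mem_stabilizer_iff] at hg
    obtain ⟨t, ⟨htT, hcoset⟩, -⟩ := hT (σ t₁ * t₁ * g)
    have htx : (σ t₁ * t₁ * g * t⁻¹) • t • x = c := by
      rw [← mul_smul, inv_mul_cancel_right, mul_smul, hg, hτ]
    have htc : CF (t • x) = c := by
      rw [← hinv _ hcoset (t • x), htx, hCFc]
    have hk : (σ t₁ * t₁ * g * t⁻¹ * (σ t)⁻¹) • c = c := by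
      have hσt : (σ t)⁻¹ • c = t • x := by
        rw [inv_smul_eq_iff, ← mul_smul, hσact t htT htc]
      rw [mul_smul, hσt, htx]
    have hfactor : g = (σ t₁ * t₁)⁻¹ * (σ t₁ * t₁ * g * t⁻¹ * (σ t)⁻¹) * (σ t₁ * t₁) *
        ((σ t₁ * t₁)⁻¹ * (σ t * t)) := by group
    rw [hfactor]
    exact mul_mem
      (Subgroup.subset_closure
        (Or.inr ⟨_, mul_mem hcoset (inv_mem (hσH t htT htc)), hk, rfl⟩))
      (Subgroup.subset_closure (Or.inl ⟨t, htT, htc, rfl⟩))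
  · rw [Subgroup.closure_le]
    rintro g (⟨t, htT, htc, rfl⟩ | ⟨k, -, hk, rfl⟩) <;>
      rw [SetLike.mem_coe, MulAction.mem_stabilizer_iff]
    · rw [mul_smul, hσact t htT htc, hτinv]
    · rw [mul_smul, hτ, mul_smul, hk, hτinv]
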